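/- Let X be a simple graph on a vertex set V which is a tree, let a group G act on V by automorphisms of X, and let x₁, x₂ be adjacent vertices of X. Suppose Γ is a subgroup of G such that for every pair of adjacent vertices v, w of X there exists γ ∈ Γ with {γ•v, γ•w} = {x₁, x₂}, and such that x₂ does not lie in the Γ-orbit of x₁. For i = 1,2 let A_i be the stabiliser of x_i in Γ. Then: A_i acts transitively on the set of neighbours of x_i in X; the stabiliser of x_{3-i} in A_i equals A₁ ∩ A₂; and the canonical homomorphism from the amalgamated free product A₁ *_{A₁∩A₂} A₂ to G induced by the two inclusions is injective with image Γ. -/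

import Mathlib

/-- The family of the two vertex groups `A₁`, `A₂`, indexed by `Bool`
(`false ↦ A₁`, `true ↦ A₂`). -/
def amalgamFam {G : Type*} [Group G] (A₁ A₂ : Subgroup G) : Bool → Subgroup G :=
  fun b => Bool.rec A₁ A₂ b

/-- The two inclusion homomorphisms `A₁ ⊓ A₂ → A_i` along which the amalgam is formed. -/
def amalgamIncl {G : Type*} [Group G] (A₁ A₂ : Subgroup G) :
    ∀ b : Bool, (↥(A₁ ⊓ A₂) →* ↥(amalgamFam A₁ A₂ b)) :=
  fun b => Bool.rec (motive := fun b => ↥(A₁ ⊓ A₂) →* ↥(amalgamFam A₁ A₂ b))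
    (Subgroup.inclusion inf_le_left) (Subgroup.inclusion inf_le_right) b

/-- The canonical homomorphism from the amalgamated free product
`A₁ *_{A₁ ⊓ A₂} A₂` (Mathlib's `Monoid.PushoutI` of the two inclusions) to `G`,
induced by the inclusions of `A₁` and `A₂` into `G`. -/
def amalgamLift {G : Type*} [Group G] (A₁ A₂ : Subgroup G) :
    Monoid.PushoutI (amalgamIncl A₁ A₂) →* G :=
  Monoid.PushoutI.lift
    (fun b => Bool.rec (motive := fun b => ↥(amalgamFam A₁ A₂ b) →* G)
      A₁.subtype A₂.subtype b)
    (A₁ ⊓ A₂).subtype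
    (by rintro (_ | _) <;> rfl)

namespace SimpleGraph

variable {V : Type*} {X : SimpleGraph V}

/-- In a tree, each vertex has at most one neighbour closer to a given vertex. -/
theorem IsTree.eq_of_adj_of_dist_lt (hX : X.IsTree) {v x y z : V} (hy : X.Adj x y)
    (hz : X.Adj x z) (hvy : X.dist v y < X.dist v x) (hvz : X.dist v z < X.dist v x) :
    y = z := by
  have exists_path : ∀ u, X.Adj x u → X.dist v u < X.dist v x →
      ∃ p : X.Walk v x, p.IsPath ∧ p.penultimate = u := by
    intro u hu hlt
    obtain ⟨p, hp⟩ := hX.connected.exists_walk_length_eq_dist v u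
    refine ⟨p.concat hu.symm, (p.concat hu.symm).isPath_of_length_eq_dist ?_,
      p.penultimate_concat hu.symm⟩
    have := X.dist_le (p.concat hu.symm)
    rw [Walk.length_concat] at this ⊢
    omega
  obtain ⟨p, hp, rfl⟩ := exists_path y hy hvy
  obtain ⟨q, hq, rfl⟩ := exists_path z hz hvz
  rw [(hX.existsUnique_path v x).unique hp hq]

variable {G : Type*} [Group G] [MulAction G V]

theorem Connected.dist_smul_smul (hX : X.Connected)
    (hact : ∀ (g : G) (v w : V), X.Adj v w → X.Adj (g • v) (g • w)) (g : G) (v w : V) :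
    X.dist (g • v) (g • w) = X.dist v w := by
  have smul_le : ∀ (g : G) (v w : V), X.dist (g • v) (g • w) ≤ X.dist v w := by
    intro g v w
    obtain ⟨p, hp⟩ := hX.exists_walk_length_eq_dist v w
    let f : X →g X := ⟨(g • ·), hact g _ _⟩
    rw [← hp, ← p.length_map f]
    exact X.dist_le (p.map f)
  refine le_antisymm (smul_le g v w) ?_
  simpa using smul_le g⁻¹ (g • v) (g • w)

/-- Removing the edge `xy` from a tree leaves two half-trees. An automorphism fixing `x` but not
`y` maps the half-tree containing `y` into the one containing `x`. -/
theorem IsTree.dist_smul_lt_dist_smul (hX : X.IsTree)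
    (hact : ∀ (g : G) (v w : V), X.Adj v w → X.Adj (g • v) (g • w)) {x y : V}
    (hxy : X.Adj x y) {g : G} (hgx : g • x = x) (hgy : g • y ≠ y) {v : V}
    (hv : X.dist v y < X.dist v x) : X.dist (g • v) x < X.dist (g • v) y := by
  rw [← hX.connected.dist_smul_smul hact g v y, ← hX.connected.dist_smul_smul hact g v x,
    hgx] at hv
  have hgxy := hact g x y hxy
  rw [hgx] at hgxy
  refine lt_of_not_ge fun hle => hgy (hX.eq_of_adj_of_dist_lt hgxy hxy hv ?_)
  exact hle.lt_of_ne (hX.dist_ne_of_adj _ hxy).symm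

variable {Γ : Subgroup G} {x y : V}

theorem exists_mem_stabilizer_smul_eq_of_adj
    (hedge : ∀ v w : V, X.Adj v w → ∃ γ ∈ Γ, ({γ • v, γ • w} : Set V) = {x, y})
    (horbit : ¬ ∃ γ ∈ Γ, γ • x = y) {v : V} (hv : X.Adj x v) :
    ∃ a ∈ Γ ⊓ MulAction.stabilizer G x, a • v = y := by
  obtain ⟨γ, hγ, h⟩ := hedge x v hv
  rcases Set.pair_eq_pair_iff.1 h with ⟨hx, hy⟩ | ⟨hx, -⟩
  · exact ⟨γ, ⟨hγ, hx⟩, hy⟩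
  · exact absurd ⟨γ, hγ, hx⟩ horbit

/-- A subgroup acting with fundamental domain the edge `xy` is contained in every subgroup
containing the stabilisers of `x` and `y`. -/
theorem Connected.le_of_stabilizer_le (hX : X.Connected)
    (hact : ∀ (g : G) (v w : V), X.Adj v w → X.Adj (g • v) (g • w)) {R : Subgroup G}
    (hRΓ : R ≤ Γ) (hxR : Γ ⊓ MulAction.stabilizer G x ≤ R)
    (hyR : Γ ⊓ MulAction.stabilizer G y ≤ R) (horbit : ¬ ∃ γ ∈ Γ, γ • x = y)
    (hx : ∀ v, X.Adj x v → ∃ a ∈ Γ ⊓ MulAction.stabilizer G x, a • v = y)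
    (hy : ∀ v, X.Adj y v → ∃ a ∈ Γ ⊓ MulAction.stabilizer G y, a • v = x) : Γ ≤ R := by
  have exists_smul : ∀ {v w : V}, X.Walk v w → w = x → ∃ r ∈ R, r • v = x ∨ r • v = y := by
    intro v w p hw
    induction p with
    | nil => exact ⟨1, R.one_mem, .inl (by rw [one_smul, hw])⟩
    | @cons u w _ huw _ ih =>
      obtain ⟨r, hr, h⟩ := ih hw
      have hadj := (hact r u w huw).symm
      rcases h with h | h <;> rw [h] at hadj
      · obtain ⟨a, ha, hau⟩ := hx _ hadj
        exact ⟨a * r, R.mul_mem (hxR ha) hr, .inr (by rwa [mul_smul])⟩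
      · obtain ⟨a, ha, hau⟩ := hy _ hadj
        exact ⟨a * r, R.mul_mem (hyR ha) hr, .inl (by rwa [mul_smul])⟩
  intro γ hγ
  obtain ⟨p⟩ := hX (γ • x) x
  obtain ⟨r, hr, h⟩ := exists_smul p rfl
  rw [← mul_smul] at h
  have hrγ : r * γ ∈ Γ := Γ.mul_mem (hRΓ hr) hγ
  rcases h with h | h
  · exact (R.mul_mem_cancel_left hr).1 (hxR ⟨hrγ, h⟩)
  · exact absurd ⟨_, hrγ, h⟩ horbit

end SimpleGraph

namespace Monoid.PushoutI

/-- A ping-pong criterion for a homomorphism from an amalgamated product to be injective. -/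
theorem injective_of_ping_pong {ι H K α : Type*} {A : ι → Type*} [∀ i, Group (A i)] [Group H]
    [Group K] [MulAction K α] {φ : ∀ i, H →* A i} (hφ : ∀ i, Function.Injective (φ i))
    (f : PushoutI φ →* K) (hbase : Function.Injective (f.comp (base φ)))
    (Y : Set α) (S : ι → Set α) (hYS : ∀ i, ¬ Y ⊆ S i)
    (hY : ∀ i, ∀ a ∉ (φ i).range, ∀ y ∈ Y, f (of i a) • y ∈ S i)
    (hS : ∀ i j, i ≠ j → ∀ a ∉ (φ i).range, ∀ y ∈ S j, f (of i a) • y ∈ S i)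
    (hbaseS : ∀ i h, ∀ y ∈ S i, f (base φ h) • y ∈ S i) :
    Function.Injective f := by
  classical
  obtain ⟨d⟩ := NormalWord.transversal_nonempty φ hφ
  have ping_pong : ∀ w : NormalWord d, (w.fstIdx = none ∧ w.prod ∈ (base φ).range) ∨
      ∃ i, w.fstIdx = some i ∧ ∀ y ∈ Y, f w.prod • y ∈ S i := by
    intro w
    induction w using NormalWord.consRecOn with
    | empty => exact .inl ⟨rfl, by simp⟩
    | cons i a w hmw _ hgr _ ih =>
      refine .inr ⟨i, by simp [CoprodI.Word.fstIdx, NormalWord.cons, CoprodI.Word.cons], ?_⟩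
      intro y hy
      rw [NormalWord.prod_cons]
      rcases ih with ⟨-, h, hh⟩ | ⟨j, hj, ih⟩
      · rw [← hh, ← of_apply_eq_base φ i, ← map_mul]
        exact hY i _ (mt (mul_mem_cancel_right (MonoidHom.mem_range.2 ⟨h, rfl⟩)).1 hgr) y hy
      · rw [map_mul, mul_smul]
        exact hS i j (fun hij => hmw (hij ▸ hj)) a hgr _ (ih y hy)
    | base h w _ ih =>
      rcases ih with ⟨hw, hr⟩ | ⟨i, hi, ih⟩
      · refine .inl ⟨hw, ?_⟩
        rw [NormalWord.prod_smul]
        exact mul_mem ⟨h, rfl⟩ hr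
      · refine .inr ⟨i, hi, fun y hy => ?_⟩
        rw [NormalWord.prod_smul, map_mul, mul_smul]
        exact hbaseS i h _ (ih y hy)
  refine (injective_iff_map_eq_one f).2 fun g hg => ?_
  obtain ⟨w, rfl⟩ := (NormalWord.equiv (d := d)).symm.surjective g
  change f w.prod = 1 at hg
  change w.prod = 1
  rcases ping_pong w with ⟨-, h, hh⟩ | ⟨i, -, hi⟩
  · rw [← hh] at hg ⊢
    rw [(injective_iff_map_eq_one _).1 hbase h hg, map_one]
  · exact absurd (fun y hy => by simpa [hg] using hi y hy) (hYS i)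

end Monoid.PushoutI

section Amalgam

open Monoid

variable {G : Type*} [Group G] (A₁ A₂ : Subgroup G)

theorem amalgamIncl_injective (b : Bool) : Function.Injective (amalgamIncl A₁ A₂ b) := by
  cases b
  · exact Subgroup.inclusion_injective inf_le_left
  · exact Subgroup.inclusion_injective inf_le_right

theorem amalgamLift_of (b : Bool) (a : amalgamFam A₁ A₂ b) :
    amalgamLift A₁ A₂ (PushoutI.of b a) = a := by
  cases b <;> exact PushoutI.lift_of ..

theorem amalgamLift_base (a : ↥(A₁ ⊓ A₂)) :
    amalgamLift A₁ A₂ (PushoutI.base _ a) = a :=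
  PushoutI.lift_base ..

theorem amalgamIncl_mem_range {b : Bool} {a : amalgamFam A₁ A₂ b} (ha : (a : G) ∈ A₁ ⊓ A₂) :
    a ∈ (amalgamIncl A₁ A₂ b).range := by
  refine ⟨⟨a, ha⟩, ?_⟩
  cases b <;> rfl

theorem range_amalgamLift : (amalgamLift A₁ A₂).range = A₁ ⊔ A₂ := by
  apply le_antisymm
  · rintro _ ⟨g, rfl⟩
    induction g using PushoutI.induction_on with
    | of b a =>
      rw [amalgamLift_of]
      cases b
      · exact Subgroup.mem_sup_left a.2
      · exact Subgroup.mem_sup_right a.2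
    | base a =>
      rw [amalgamLift_base]
      exact Subgroup.mem_sup_left a.2.1
    | mul g h hg hh =>
      rw [map_mul]
      exact mul_mem hg hh
  · refine sup_le (fun a ha => ?_) (fun a ha => ?_)
    · exact ⟨PushoutI.of false ⟨a, ha⟩, amalgamLift_of A₁ A₂ false ⟨a, ha⟩⟩
    · exact ⟨PushoutI.of true ⟨a, ha⟩, amalgamLift_of A₁ A₂ true ⟨a, ha⟩⟩

/-- The amalgam of the stabilisers of the two ends of an edge of a tree embeds in the group. -/
theorem amalgamLift_stabilizer_injective {V : Type*} [MulAction G V] {X : SimpleGraph V}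
    (hX : X.IsTree) (hact : ∀ (g : G) (v w : V), X.Adj v w → X.Adj (g • v) (g • w))
    {x₁ x₂ : V} (hadj : X.Adj x₁ x₂) (Γ : Subgroup G) :
    Function.Injective
      (amalgamLift (Γ ⊓ MulAction.stabilizer G x₁) (Γ ⊓ MulAction.stabilizer G x₂)) := by
  have half_tree : ∀ {x y : V}, X.Adj x y → ∀ {g : G}, g • x = x → g • y ≠ y →
      ∀ {v : V}, X.dist v y < X.dist v x ∨ v = x →
        X.dist (g • v) x < X.dist (g • v) y := by
    rintro x y hxy g hgx hgy v (hv | rfl)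
    · exact hX.dist_smul_lt_dist_smul hact hxy hgx hgy hv
    · rw [hgx, SimpleGraph.dist_self]
      exact hX.connected.pos_dist_of_ne hxy.ne
  have h₁₂ : X.dist x₁ x₂ = 1 := SimpleGraph.dist_eq_one_iff_adj.2 hadj
  have h₂₁ : X.dist x₂ x₁ = 1 := SimpleGraph.dist_eq_one_iff_adj.2 hadj.symm
  have smul_ne₁ : ∀ a ∉ (amalgamIncl (Γ ⊓ MulAction.stabilizer G x₁)
      (Γ ⊓ MulAction.stabilizer G x₂) false).range, (a : G) • x₂ ≠ x₂ :=
    fun a ha h => ha (amalgamIncl_mem_range _ _ ⟨a.2, a.2.1, h⟩)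
  have smul_ne₂ : ∀ a ∉ (amalgamIncl (Γ ⊓ MulAction.stabilizer G x₁)
      (Γ ⊓ MulAction.stabilizer G x₂) true).range, (a : G) • x₁ ≠ x₁ :=
    fun a ha h => ha (amalgamIncl_mem_range _ _ ⟨⟨a.2.1, h⟩, a.2⟩)
  refine PushoutI.injective_of_ping_pong (amalgamIncl_injective _ _) _ ?_ {x₁, x₂}
    (fun b => bif b then {v | X.dist v x₂ < X.dist v x₁} else {v | X.dist v x₁ < X.dist v x₂})
    ?_ ?_ ?_ ?_
  · intro a b h
    simpa [amalgamLift_base] using h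
  · rintro (_ | _) h
    · simpa using h (Set.mem_insert_of_mem _ rfl)
    · simpa using h (Set.mem_insert _ _)
  · rintro (_ | _) a ha y hy <;> rw [amalgamLift_of]
    · refine half_tree hadj a.2.2 (smul_ne₁ a ha) ?_
      rcases hy with rfl | rfl <;> simp [h₂₁]
    · refine half_tree hadj.symm a.2.2 (smul_ne₂ a ha) ?_
      rcases hy with rfl | rfl <;> simp [h₁₂]
  · rintro (_ | _) (_ | _) hij a ha y hy <;> rw [amalgamLift_of]
    · exact absurd rfl hij
    · exact half_tree hadj a.2.2 (smul_ne₁ a ha) (.inl hy)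
    · exact half_tree hadj.symm a.2.2 (smul_ne₂ a ha) (.inl hy)
    · exact absurd rfl hij
  · intro b a y hy
    rw [amalgamLift_base]
    have hd₁ := hX.connected.dist_smul_smul hact (a : G) y x₁
    have hd₂ := hX.connected.dist_smul_smul hact (a : G) y x₂
    rw [show (a : G) • x₁ = x₁ from a.2.1.2] at hd₁
    rw [show (a : G) • x₂ = x₂ from a.2.2.2] at hd₂
    cases b <;> simpa [hd₁, hd₂] using hy

end Amalgam

/-- Let `X` be a tree on a vertex set `V`, let a group `G` act on `V` by
automorphisms of `X`, and let `x₁, x₂` be adjacent vertices.  Suppose `Γ ≤ G` acts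
transitively on the (unordered) edges of `X` with fundamental edge `{x₁, x₂}`, and `x₂` is
not in the `Γ`-orbit of `x₁`.  Let `A_i` be the stabiliser of `x_i` in `Γ`.  Then `A_i`
acts transitively on the neighbours of `x_i`, `Stab_{A_i}(x_{3-i}) = A₁ ⊓ A₂`, and the
canonical homomorphism `A₁ *_{A₁ ⊓ A₂} A₂ → G` is injective with image `Γ`. -/
theorem edge_transitive_lattice_is_amalgam
    {V G : Type*} [Group G] [MulAction G V]
    (X : SimpleGraph V) (hX : X.IsTree)
    (hact : ∀ (g : G) (v w : V), X.Adj v w → X.Adj (g • v) (g • w))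
    (x₁ x₂ : V) (hadj : X.Adj x₁ x₂)
    (Γ : Subgroup G)
    (hedge : ∀ v w : V, X.Adj v w → ∃ γ ∈ Γ, ({γ • v, γ • w} : Set V) = {x₁, x₂})
    (horbit : ¬ ∃ γ ∈ Γ, γ • x₁ = x₂) :
    (∀ v w : V, X.Adj x₁ v → X.Adj x₁ w →
      ∃ a ∈ Γ ⊓ MulAction.stabilizer G x₁, a • v = w) ∧
    (∀ v w : V, X.Adj x₂ v → X.Adj x₂ w →
      ∃ a ∈ Γ ⊓ MulAction.stabilizer G x₂, a • v = w) ∧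
    (Γ ⊓ MulAction.stabilizer G x₁) ⊓ MulAction.stabilizer G x₂ =
      (Γ ⊓ MulAction.stabilizer G x₁) ⊓ (Γ ⊓ MulAction.stabilizer G x₂) ∧
    (Γ ⊓ MulAction.stabilizer G x₂) ⊓ MulAction.stabilizer G x₁ =
      (Γ ⊓ MulAction.stabilizer G x₁) ⊓ (Γ ⊓ MulAction.stabilizer G x₂) ∧
    Function.Injective
      (amalgamLift (Γ ⊓ MulAction.stabilizer G x₁) (Γ ⊓ MulAction.stabilizer G x₂)) ∧
    (amalgamLift (Γ ⊓ MulAction.stabilizer G x₁) (Γ ⊓ MulAction.stabilizer G x₂)).range = Γ := by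
  have horbit' : ¬ ∃ γ ∈ Γ, γ • x₂ = x₁ := fun ⟨γ, hγ, h⟩ =>
    horbit ⟨γ⁻¹, Γ.inv_mem hγ, by rw [← h, inv_smul_smul]⟩
  have hx₁ : ∀ v, X.Adj x₁ v → ∃ a ∈ Γ ⊓ MulAction.stabilizer G x₁, a • v = x₂ := fun _ =>
    SimpleGraph.exists_mem_stabilizer_smul_eq_of_adj hedge horbit
  have hx₂ : ∀ v, X.Adj x₂ v → ∃ a ∈ Γ ⊓ MulAction.stabilizer G x₂, a • v = x₁ := fun _ =>
    SimpleGraph.exists_mem_stabilizer_smul_eq_of_adj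
      (fun v w h => Set.pair_comm x₁ x₂ ▸ hedge v w h) horbit'
  have transitive : ∀ {A : Subgroup G} {x y : V},
      (∀ v, X.Adj x v → ∃ a ∈ A, a • v = y) →
      ∀ v w, X.Adj x v → X.Adj x w → ∃ a ∈ A, a • v = w := by
    intro A x y h v w hv hw
    obtain ⟨a, ha, hav⟩ := h v hv
    obtain ⟨b, hb, hbw⟩ := h w hw
    exact ⟨b⁻¹ * a, A.mul_mem (A.inv_mem hb) ha, by rw [mul_smul, hav, ← hbw, inv_smul_smul]⟩
  refine ⟨transitive hx₁, transitive hx₂, ?_, ?_,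
    amalgamLift_stabilizer_injective hX hact hadj Γ, ?_⟩
  · ext
    simp only [Subgroup.mem_inf]
    tauto
  · ext
    simp only [Subgroup.mem_inf]
    tauto
  · rw [range_amalgamLift]
    have hle := sup_le (inf_le_left : Γ ⊓ MulAction.stabilizer G x₁ ≤ Γ)
      (inf_le_left : Γ ⊓ MulAction.stabilizer G x₂ ≤ Γ)
    exact le_antisymm hle (hX.connected.le_of_stabilizer_le hact hle le_sup_left le_sup_right
      horbit hx₁ hx₂)
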